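/- Let η ∈ (0,1), let σ ≥ 0 be a real number, let A be a W × d real matrix with M = Aᵀ·A, and let C be a d × d real symmetric matrix such that M − σ·I ⪯ C ⪯ (1/(1 − η))·M + σ·I. Let Π be the set of d × d real matrices P with P² = P, Pᵀ = P, and rank(P) = k, where k ≤ d. Suppose X̃ ∈ Π satisfies trace((I − X̃)ᵀ·C·(I − X̃)) ≤ trace((I − P)ᵀ·C·(I − P)) for all P ∈ Π, and P̂ ∈ Π satisfies ‖A·(I − P̂)‖_F² ≤ ‖A·(I − P)‖_F² for all P ∈ Π. Then ‖A·(I − X̃)‖_F² ≤ (1/(1 − η))·‖A·(I − P̂)‖_F² + 2·d·σ. -/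

import Mathlib

open Matrix

/-- The Frobenius norm of a real matrix. -/
noncomputable def frob {α β : Type*} [Fintype α] [Fintype β] (A : Matrix α β ℝ) : ℝ :=
  Real.sqrt (∑ i, ∑ j, (A i j) ^ 2)

/-- The Loewner partial order on real square matrices: `M ⪯ N` iff `N - M` is
positive semidefinite. -/
def LoewnerLE {d : ℕ} (M N : Matrix (Fin d) (Fin d) ℝ) : Prop := (N - M).PosSemidef

theorem frob_sq {α β : Type*} [Fintype α] [Fintype β] (A : Matrix α β ℝ) :
    frob A ^ 2 = (Aᵀ * A).trace := by
  rw [frob, Real.sq_sqrt (by positivity), Finset.sum_comm]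
  simp [Matrix.trace, Matrix.mul_apply, sq]

theorem frob_mul_sq {α β γ : Type*} [Fintype α] [Fintype β] [Fintype γ]
    (A : Matrix α β ℝ) (Q : Matrix β γ ℝ) :
    frob (A * Q) ^ 2 = (Qᵀ * (Aᵀ * A) * Q).trace := by
  rw [frob_sq, Matrix.transpose_mul]
  simp only [Matrix.mul_assoc]

/-- Compression by `Q` followed by the trace is monotone for the Loewner order. -/
theorem LoewnerLE.trace_compression_le {d : ℕ} {M N : Matrix (Fin d) (Fin d) ℝ}
    (h : LoewnerLE M N) (Q : Matrix (Fin d) (Fin d) ℝ) :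
    (Qᵀ * M * Q).trace ≤ (Qᵀ * N * Q).trace := by
  have h0 := (Matrix.PosSemidef.conjTranspose_mul_mul_same h Q).trace_nonneg
  rw [Matrix.conjTranspose_eq_transpose_of_trivial, Matrix.mul_sub, Matrix.sub_mul,
    Matrix.trace_sub] at h0
  exact sub_nonneg.mp h0

theorem trace_one_sub_transpose_mul_self_le {d : ℕ} {P : Matrix (Fin d) (Fin d) ℝ}
    (hP : P * P = P) (hPt : Pᵀ = P) : ((1 - P)ᵀ * (1 - P)).trace ≤ (d : ℝ) := by
  have h0 : 0 ≤ P.trace := by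
    have := frob_sq P
    rw [hPt, hP] at this
    exact this ▸ sq_nonneg _
  have h1 : (1 - P)ᵀ * (1 - P) = 1 - P := by
    rw [Matrix.transpose_sub, Matrix.transpose_one, hPt]
    simp [Matrix.mul_sub, Matrix.sub_mul, hP]
  rw [h1, Matrix.trace_sub, Matrix.trace_one, Fintype.card_fin]
  linarith

theorem stmt11 (W d k : ℕ) (hk : k ≤ d) (η σ : ℝ) (hη0 : 0 < η) (hη1 : η < 1) (hσ : 0 ≤ σ)
    (A : Matrix (Fin W) (Fin d) ℝ) (C : Matrix (Fin d) (Fin d) ℝ) (hC : C.IsSymm)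
    (h1 : LoewnerLE (Aᵀ * A - σ • (1 : Matrix (Fin d) (Fin d) ℝ)) C)
    (h2 : LoewnerLE C ((1 / (1 - η)) • (Aᵀ * A) + σ • (1 : Matrix (Fin d) (Fin d) ℝ)))
    (Ps : Set (Matrix (Fin d) (Fin d) ℝ))
    (hPs : Ps = {P | P * P = P ∧ Pᵀ = P ∧ P.rank = k})
    (Xt : Matrix (Fin d) (Fin d) ℝ) (hXt : Xt ∈ Ps)
    (hXtopt : ∀ P ∈ Ps, ((1 - Xt)ᵀ * C * (1 - Xt)).trace ≤ ((1 - P)ᵀ * C * (1 - P)).trace)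
    (Ph : Matrix (Fin d) (Fin d) ℝ) (hPh : Ph ∈ Ps)
    (hPhopt : ∀ P ∈ Ps, frob (A * (1 - Ph)) ^ 2 ≤ frob (A * (1 - P)) ^ 2) :
    frob (A * (1 - Xt)) ^ 2 ≤ (1 / (1 - η)) * frob (A * (1 - Ph)) ^ 2 + 2 * (d : ℝ) * σ := by
  subst hPs
  have hX := h1.trace_compression_le (1 - Xt)
  have hP := h2.trace_compression_le (1 - Ph)
  have hopt := hXtopt Ph hPh
  have hXd := mul_le_mul_of_nonneg_left
    (trace_one_sub_transpose_mul_self_le hXt.1 hXt.2.1) hσ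
  have hPd := mul_le_mul_of_nonneg_left
    (trace_one_sub_transpose_mul_self_le hPh.1 hPh.2.1) hσ
  rw [Matrix.mul_sub _ (Aᵀ * A), Matrix.sub_mul, Matrix.trace_sub, ← frob_mul_sq, Matrix.mul_smul,
    Matrix.smul_mul, Matrix.trace_smul, Matrix.mul_one, smul_eq_mul] at hX
  rw [Matrix.mul_add, Matrix.add_mul, Matrix.trace_add, Matrix.mul_smul, Matrix.smul_mul,
    Matrix.trace_smul, ← frob_mul_sq, Matrix.mul_smul, Matrix.smul_mul, Matrix.trace_smul,
    Matrix.mul_one, smul_eq_mul, smul_eq_mul] at hP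
  linarith
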